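/- The one-way atomic decomposition does not preserve termination of the equivalent chase: the rule set 𝓡 = {P(x,y) → ∃z.(P(y,z) ∧ P(z,y))} belongs to CT_E^∀, but 1ad(𝓡) = {P(x,y) → ∃z.X(y,z); X(y,z) → P(y,z); X(y,z) → P(z,y)} does not belong to CT_E^∀; in particular the knowledge base ⟨1ad(𝓡), {P(a,b)}⟩ admits no finite fair E-derivation (equivalently, no finite universal model), while every knowledge base ⟨𝓡,F⟩ admits one. -/

import Mathlib

namespace ExRules

open scoped Classical

noncomputable section

/-- Terms: constants or variables, each indexed by a natural number. -/
inductive Term where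
  | const : ℕ → Term
  | var : ℕ → Term
deriving DecidableEq

/-- An atom: a predicate symbol applied to a list of terms (the arity of the
predicate is the length of the argument list). -/
structure Atom where
  pred : ℕ
  args : List Term
deriving DecidableEq

/-- A factbase is a finite set of atoms. -/
abbrev FactBase := Finset Atom

/-- A substitution: a map on variables (extended by the identity on constants). -/
abbrev Subst := ℕ → Term

def applyTerm (σ : Subst) : Term → Term
  | .const c => .const c
  | .var v => σ v

def Atom.subst (σ : Subst) (a : Atom) : Atom := ⟨a.pred, a.args.map (applyTerm σ)⟩

def Term.vars : Term → Finset ℕ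
  | .const _ => ∅
  | .var v => {v}

def Atom.vars (a : Atom) : Finset ℕ := a.args.foldr (fun t s => t.vars ∪ s) ∅

def FactBase.vars (F : FactBase) : Finset ℕ := F.sup Atom.vars

/-- The variables occurring in a (possibly infinite) set of atoms. -/
def setVars (S : Set Atom) : Set ℕ := {v | ∃ a ∈ S, v ∈ a.vars}

/-- `σ` is a homomorphism from the atom set `S` to the atom set `S'`. -/
def IsHom (σ : Subst) (S S' : Set Atom) : Prop := ∀ a ∈ S, a.subst σ ∈ S'

/-- A retraction is a homomorphism that is the identity on the common variables. -/
def IsRetraction (σ : Subst) (S S' : Set Atom) : Prop :=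
  IsHom σ S S' ∧ ∀ v, v ∈ setVars S → v ∈ setVars S' → σ v = Term.var v

/-- An existential rule `B → ∃z.H` with nonempty body and head.  The frontier and
the existential variables are determined by the variables shared between body and
head. -/
structure Rule where
  body : Finset Atom
  head : Finset Atom
  body_nonempty : body.Nonempty
  head_nonempty : head.Nonempty

instance : DecidableEq Rule := fun R S =>
  decidable_of_iff (R.body = S.body ∧ R.head = S.head) (by
    constructor
    · rintro ⟨h1, h2⟩
      cases R; cases S; simp_all
    · rintro rfl; exact ⟨rfl, rfl⟩)

/-- The frontier of a rule: the variables shared by body and head. -/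
def Rule.frontier (R : Rule) : Finset ℕ := FactBase.vars R.body ∩ FactBase.vars R.head

/-- The existential variables of a rule: head variables not occurring in the body. -/
def Rule.exVars (R : Rule) : Finset ℕ := FactBase.vars R.head \ FactBase.vars R.body

/-- A rule is Datalog if it has no existential variable. -/
def Rule.IsDatalog (R : Rule) : Prop := R.exVars = ∅

/-- A rule has an atomic head if its head is a single atom. -/
def Rule.IsAtomicHead (R : Rule) : Prop := R.head.card = 1

/-- A rule set is a finite set of existential rules. -/
abbrev RuleSet := Finset Rule

instance : Encodable Term :=
  Encodable.ofEquiv (ℕ ⊕ ℕ)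
    { toFun := fun t => match t with | .const c => .inl c | .var v => .inr v
      invFun := fun s => match s with | .inl c => .const c | .inr v => .var v
      left_inv := by intro t; cases t <;> rfl
      right_inv := by intro s; cases s <;> rfl }

instance : Encodable Atom :=
  Encodable.ofEquiv (ℕ × List Term)
    { toFun := fun a => (a.pred, a.args)
      invFun := fun p => ⟨p.1, p.2⟩
      left_inv := fun _ => rfl
      right_inv := fun _ => rfl }

instance : Encodable Rule :=
  Encodable.ofEquiv {p : Finset Atom × Finset Atom // p.1.Nonempty ∧ p.2.Nonempty}
    { toFun := fun R => ⟨(R.body, R.head), R.body_nonempty, R.head_nonempty⟩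
      invFun := fun p => ⟨p.1.1, p.1.2, p.2.1, p.2.2⟩
      left_inv := fun _ => rfl
      right_inv := fun _ => rfl }

/-- A trigger `(R, π)`: a rule together with a substitution. -/
structure Trigger where
  rule : Rule
  map : Subst

/-- The canonical fresh variable `z_t` associated to a trigger `t` and an
existential variable `z`: it is unique for `z` and (the relevant part of) `t`. -/
def Trigger.freshVar (t : Trigger) (z : ℕ) : ℕ :=
  Nat.pair
    (Encodable.encode (t.rule, ((FactBase.vars t.rule.body).sort (· ≤ ·)).map t.map)) z

/-- The extension `π_R` of the substitution of a trigger, mapping each existential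
variable `z` to the fresh variable `z_t`. -/
def Trigger.ext (t : Trigger) : Subst := fun v =>
  if v ∈ t.rule.exVars then Term.var (t.freshVar v) else t.map v

/-- The output of a trigger: `out(t) = π_R(H)`. -/
def Trigger.out (t : Trigger) : Finset Atom := t.rule.head.image (Atom.subst t.ext)

/-- `t` is a trigger on the factbase `F`: its substitution is a homomorphism from
the body of its rule to `F`. -/
def Trigger.IsOn (t : Trigger) (F : FactBase) : Prop := IsHom t.map ↑t.rule.body ↑F

/-- The chase variants: oblivious, semi-oblivious, restricted, equivalent. -/
inductive Variant where
  | O | SO | R | E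

/-- Applicability of a trigger on a factbase, for each chase variant. -/
def Applicable : Variant → Trigger → FactBase → Prop
  | .O, t, F => ¬ t.out ⊆ F
  | .SO, t, F => ∀ t' : Trigger, t'.rule = t.rule →
      (∀ v ∈ t.rule.frontier, t'.map v = t.map v) → ¬ t'.out ⊆ F
  | .R, t, F => ¬ ∃ σ : Subst, IsRetraction σ ↑(F ∪ t.out) ↑F
  | .E, t, F => ¬ ∃ σ : Subst, IsHom σ ↑(F ∪ t.out) ↑F

/-- An atom set `M` satisfies a rule `B → ∃z.H` if every homomorphism from `B`
to `M` extends to a homomorphism mapping `H` into `M`. -/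
def SatisfiesRule (M : Set Atom) (R : Rule) : Prop :=
  ∀ σ : Subst, IsHom σ ↑R.body M →
    ∃ σ' : Subst, (∀ v ∈ FactBase.vars R.body, σ' v = σ v) ∧ IsHom σ' ↑R.head M

/-- A (finite or infinite) derivation from the knowledge base `⟨𝓡, F⟩`:
`len` is the number of triggers (possibly `⊤`), `fb i` is the `i`-th factbase and,
for `i < len`, `tr i` is the trigger producing `fb (i+1)` from `fb i`. -/
structure Derivation (𝓡 : RuleSet) (F : FactBase) where
  len : ℕ∞
  fb : ℕ → FactBase
  tr : ℕ → Trigger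
  fb_zero : fb 0 = F
  rule_mem : ∀ i : ℕ, (i : ℕ∞) < len → (tr i).rule ∈ 𝓡
  trig_on : ∀ i : ℕ, (i : ℕ∞) < len → (tr i).IsOn (fb i)
  trig_new : ∀ i : ℕ, (i : ℕ∞) < len → ¬ (tr i).out ⊆ fb i
  fb_succ : ∀ i : ℕ, (i : ℕ∞) < len → fb (i + 1) = fb i ∪ (tr i).out
  fb_stall : ∀ i : ℕ, ¬ (i : ℕ∞) < len → fb (i + 1) = fb i

namespace Derivation

variable {𝓡 : RuleSet} {F : FactBase}

/-- An `X`-derivation: every applied trigger is `X`-applicable when applied. -/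
def IsX (X : Variant) (D : Derivation 𝓡 F) : Prop :=
  ∀ i : ℕ, (i : ℕ∞) < D.len → Applicable X (D.tr i) (D.fb i)

/-- Datalog-first: a non-Datalog rule is only applied when all Datalog rules of
the rule set are satisfied. -/
def DatalogFirst (D : Derivation 𝓡 F) : Prop :=
  ∀ i : ℕ, (i : ℕ∞) < D.len → ¬ (D.tr i).rule.IsDatalog →
    ∀ R ∈ 𝓡, R.IsDatalog → SatisfiesRule ↑(D.fb i) R

/-- Fairness: every trigger `X`-applicable on some factbase of the derivation is
eventually not `X`-applicable. -/
def Fair (X : Variant) (D : Derivation 𝓡 F) : Prop :=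
  ∀ i : ℕ, (i : ℕ∞) ≤ D.len → ∀ t : Trigger, t.rule ∈ 𝓡 → t.IsOn (D.fb i) →
    Applicable X t (D.fb i) →
    ∃ j : ℕ, i < j ∧ (j : ℕ∞) ≤ D.len ∧ ¬ Applicable X t (D.fb j)

/-- A derivation is finite if its length is not `⊤`. -/
def Finite (D : Derivation 𝓡 F) : Prop := D.len ≠ ⊤

end Derivation

/-- `CT_X^∀` (non-Datalog-first): every fair `X`-derivation from every KB is finite. -/
def CTall (X : Variant) (𝓡 : RuleSet) : Prop :=
  ∀ F : FactBase, ∀ D : Derivation 𝓡 F, D.IsX X → D.Fair X → D.Finite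

/-- `CT_X^∃`: some fair `X`-derivation from every KB is finite. -/
def CTex (X : Variant) (𝓡 : RuleSet) : Prop :=
  ∀ F : FactBase, ∃ D : Derivation 𝓡 F, D.IsX X ∧ D.Fair X ∧ D.Finite

/-- `CT_{df-X}^∀`: every fair Datalog-first `X`-derivation from every KB is finite. -/
def CTallDF (X : Variant) (𝓡 : RuleSet) : Prop :=
  ∀ F : FactBase, ∀ D : Derivation 𝓡 F, D.IsX X → D.DatalogFirst → D.Fair X → D.Finite

/-- `CT_{df-X}^∃`: some fair Datalog-first `X`-derivation from every KB is finite. -/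
def CTexDF (X : Variant) (𝓡 : RuleSet) : Prop :=
  ∀ F : FactBase, ∃ D : Derivation 𝓡 F, D.IsX X ∧ D.DatalogFirst ∧ D.Fair X ∧ D.Finite

/-! ### Single-piece decomposition -/

/-- Adjacency in the piece graph of a rule: two head atoms sharing an existential
variable. -/
def PieceAdj (R : Rule) (a b : Atom) : Prop :=
  a ∈ R.head ∧ b ∈ R.head ∧ (a.vars ∩ b.vars ∩ R.exVars).Nonempty

/-- The piece (connected component of the piece graph) containing a given head atom. -/
def pieceOf (R : Rule) (a : Atom) : Finset Atom :=
  R.head.filter fun b => Relation.ReflTransGen (PieceAdj R) a b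

theorem self_mem_pieceOf {R : Rule} {a : Atom} (h : a ∈ R.head) : a ∈ pieceOf R a := by
  rw [pieceOf, Finset.mem_filter]
  exact ⟨h, Relation.ReflTransGen.refl⟩

/-- The single-piece decomposition of a rule. -/
def Rule.sp (R : Rule) : Finset Rule :=
  R.head.attach.image fun a =>
    ⟨R.body, pieceOf R a.1, R.body_nonempty, ⟨a.1, self_mem_pieceOf a.2⟩⟩

/-- The single-piece decomposition of a rule set. -/
def spSet (𝓡 : RuleSet) : RuleSet := 𝓡.biUnion Rule.sp

/-! ### Atomic decompositions -/

/-- The predicates occurring in a rule set. -/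
def RuleSet.predsF (𝓡 : RuleSet) : Finset ℕ :=
  𝓡.sup fun R => (R.body.image Atom.pred) ∪ (R.head.image Atom.pred)

/-- A fresh predicate `X_R`, unique for `R` and not occurring in `𝓡`. -/
def freshPred (𝓡 : RuleSet) (R : Rule) : ℕ :=
  (RuleSet.predsF 𝓡).sup id + 1 + Encodable.encode R

/-- The atom `X_R(x, z)` over the fresh predicate, whose arguments are the frontier
variables followed by the existential variables of `R`. -/
def xAtom (𝓡 : RuleSet) (R : Rule) : Atom :=
  ⟨freshPred 𝓡 R,
    ((R.frontier.sort (· ≤ ·)).map Term.var) ++ ((R.exVars.sort (· ≤ ·)).map Term.var)⟩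

/-- The one-way atomic decomposition of a rule `R = B → ∃z.H` (relative to `𝓡`):
the rule `B → ∃z.X_R(x,z)` together with a rule `X_R(x,z) → P(t)` for each head atom. -/
def oneAdRule (𝓡 : RuleSet) (R : Rule) : Finset Rule :=
  insert ⟨R.body, {xAtom 𝓡 R}, R.body_nonempty, Finset.singleton_nonempty _⟩
    (R.head.attach.image fun a =>
      ⟨{xAtom 𝓡 R}, {a.1}, Finset.singleton_nonempty _, Finset.singleton_nonempty _⟩)

/-- The one-way atomic decomposition of a rule set. -/
def oneAd (𝓡 : RuleSet) : RuleSet := 𝓡.biUnion (oneAdRule 𝓡)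

/-- The two-way atomic decomposition: `2ad(R) = 1ad(R) ∪ {H[x,z] → X_R(x,z)}`. -/
def twoAd (𝓡 : RuleSet) : RuleSet :=
  oneAd 𝓡 ∪ 𝓡.image fun R =>
    ⟨R.head, {xAtom 𝓡 R}, R.head_nonempty, Finset.singleton_nonempty _⟩

/-! ### Models, entailment, BDDP -/

/-- `M` is a model of the rule set `𝓡`. -/
def IsModelOfRules (𝓡 : RuleSet) (M : Set Atom) : Prop := ∀ R ∈ 𝓡, SatisfiesRule M R

/-- `M` is a model of the knowledge base `⟨𝓡, F⟩`. -/
def IsModelOfKB (𝓡 : RuleSet) (F : FactBase) (M : Set Atom) : Prop :=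
  IsModelOfRules 𝓡 M ∧ ∃ σ : Subst, IsHom σ ↑F M

/-- `M` is a universal model of `⟨𝓡, F⟩`: a model mapping homomorphically into
every model. -/
def IsUniversalModel (𝓡 : RuleSet) (F : FactBase) (M : Set Atom) : Prop :=
  IsModelOfKB 𝓡 F M ∧ ∀ N : Set Atom, IsModelOfKB 𝓡 F N → ∃ σ : Subst, IsHom σ M N

/-- An atom set entails a Boolean conjunctive query `Q` if `Q` maps
homomorphically into it. -/
def EntailsQ (S : Set Atom) (Q : Finset Atom) : Prop := ∃ σ : Subst, IsHom σ ↑Q S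

/-- `⟨𝓡, F⟩ ⊨ Q`: every model of the KB entails `Q`. -/
def KBEntails (𝓡 : RuleSet) (F : FactBase) (Q : Finset Atom) : Prop :=
  ∀ M : Set Atom, IsModelOfKB 𝓡 F M → EntailsQ M Q

/-- `R(F)`: the minimal atom set including `F` and `out(t)` for every trigger `t`
with rule `R` on `F`. -/
def ruleStep (R : Rule) (S : Set Atom) : Set Atom :=
  S ∪ {a | ∃ t : Trigger, t.rule = R ∧ IsHom t.map ↑R.body S ∧ a ∈ t.out}

/-- `𝓡(F) = ⋃_{R ∈ 𝓡} R(F)` (together with `F`). -/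
def setStep (𝓡 : RuleSet) (S : Set Atom) : Set Atom := S ∪ ⋃ R ∈ 𝓡, ruleStep R S

/-- The breadth-first chase `Ch_i(⟨𝓡, F⟩)`. -/
def ch (𝓡 : RuleSet) (F : FactBase) : ℕ → Set Atom
  | 0 => ↑F
  | i + 1 => setStep 𝓡 (ch 𝓡 F i)

/-- The bounded derivation depth property. -/
def BDDP (𝓡 : RuleSet) : Prop :=
  ∀ Q : Finset Atom, ∃ k : ℕ, ∀ F : FactBase, KBEntails 𝓡 F Q ↔ EntailsQ (ch 𝓡 F k) Q

/-! ### Conservative extensions -/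

/-- The restriction of an atom set to the atoms over a given set of predicates. -/
def restrictTo (M : Set Atom) (P : Set ℕ) : Set Atom := {a ∈ M | a.pred ∈ P}

/-- The terms (domain elements) of an atom set. -/
def termsOf (M : Set Atom) : Set Term := {u | ∃ a ∈ M, u ∈ a.args}

/-- `𝓡'` is a conservative extension of `𝓡`. -/
def ConservativeExt (𝓡 𝓡' : RuleSet) : Prop :=
  (↑(RuleSet.predsF 𝓡) : Set ℕ) ⊆ ↑(RuleSet.predsF 𝓡') ∧
  (∀ M : Set Atom, IsModelOfRules 𝓡' M →
    IsModelOfRules 𝓡 (restrictTo M ↑(RuleSet.predsF 𝓡))) ∧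
  (∀ M : Set Atom, IsModelOfRules 𝓡 M →
    ∃ M' : Set Atom, M ⊆ M' ∧ IsModelOfRules 𝓡' M' ∧ termsOf M' = termsOf M ∧
      restrictTo M' ↑(RuleSet.predsF 𝓡) = restrictTo M ↑(RuleSet.predsF 𝓡))

/-- `𝓡'` is a universal-conservative extension of `𝓡`. -/
def UnivConservativeExt (𝓡 𝓡' : RuleSet) : Prop :=
  (↑(RuleSet.predsF 𝓡) : Set ℕ) ⊆ ↑(RuleSet.predsF 𝓡') ∧
  ∀ F : FactBase, (∀ a ∈ F, a.pred ∈ RuleSet.predsF 𝓡) →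
    (∀ M : Set Atom, IsUniversalModel 𝓡' F M →
      IsUniversalModel 𝓡 F (restrictTo M ↑(RuleSet.predsF 𝓡))) ∧
    (∀ M : Set Atom, IsUniversalModel 𝓡 F M →
      ∃ M' : Set Atom, M ⊆ M' ∧ IsUniversalModel 𝓡' F M' ∧ termsOf M' = termsOf M ∧
        restrictTo M' ↑(RuleSet.predsF 𝓡) = restrictTo M ↑(RuleSet.predsF 𝓡))

def aP (t u : Term) : Atom := ⟨0, [t, u]⟩
def vx : Term := Term.var 0
def vy : Term := Term.var 1
def vz : Term := Term.var 2

/-- `𝓡₀ = {P(x,y) → ∃z.(P(y,z) ∧ P(z,y))}`. -/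
def R0set : RuleSet :=
  { ⟨{aP vx vy}, {aP vy vz, aP vz vy},
      Finset.singleton_nonempty _, Finset.insert_nonempty _ _⟩ }

/-- The factbase `{P(a,b)}`. -/
def Fab : FactBase := {aP (Term.const 0) (Term.const 1)}

/-! ### Substitutions and variables -/

theorem mem_atom_vars {a : Atom} {v : ℕ} : v ∈ a.vars ↔ Term.var v ∈ a.args := by
  obtain ⟨p, l⟩ := a
  simp only [Atom.vars]
  induction l with
  | nil => simp
  | cons t l ih =>
    rw [List.foldr_cons, Finset.mem_union, ih]
    cases t <;> simp [Term.vars]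

theorem mem_factBase_vars {F : FactBase} {v : ℕ} :
    v ∈ FactBase.vars F ↔ ∃ a ∈ F, v ∈ a.vars := by
  simp [FactBase.vars, Finset.mem_sup]

theorem mem_factBase_vars_of_mem {F : FactBase} {a : Atom} {v : ℕ} (ha : a ∈ F)
    (hv : v ∈ a.vars) : v ∈ FactBase.vars F :=
  mem_factBase_vars.2 ⟨a, ha, hv⟩

theorem factBase_vars_union {F G : FactBase} {v : ℕ} :
    v ∈ FactBase.vars (F ∪ G) ↔ v ∈ FactBase.vars F ∨ v ∈ FactBase.vars G := by
  simp only [mem_factBase_vars, Finset.mem_union, or_and_right, exists_or]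

theorem applyTerm_congr {σ τ : Subst} {t : Term} (h : ∀ v, t = Term.var v → σ v = τ v) :
    applyTerm σ t = applyTerm τ t := by
  cases t with
  | const c => rfl
  | var v => exact h v rfl

theorem applyTerm_var (t : Term) : applyTerm Term.var t = t := by
  cases t <;> rfl

theorem applyTerm_applyTerm (σ τ : Subst) (t : Term) :
    applyTerm τ (applyTerm σ t) = applyTerm (fun v => applyTerm τ (σ v)) t := by
  cases t <;> rfl

theorem Atom.subst_congr {σ τ : Subst} {a : Atom} (h : ∀ v ∈ a.vars, σ v = τ v) :
    a.subst σ = a.subst τ := by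
  simp only [Atom.subst, Atom.mk.injEq, true_and]
  refine List.map_congr_left fun t ht => applyTerm_congr ?_
  rintro v rfl
  exact h v (mem_atom_vars.2 ht)

theorem Atom.subst_var (a : Atom) : a.subst Term.var = a := by
  have : applyTerm Term.var = id := funext applyTerm_var
  simp [Atom.subst, this]

theorem Atom.subst_subst (σ τ : Subst) (a : Atom) :
    (a.subst σ).subst τ = a.subst fun v => applyTerm τ (σ v) := by
  simp [Atom.subst, applyTerm_applyTerm]

theorem Atom.mem_vars_subst {σ : Subst} {a : Atom} {v w : ℕ} (hw : w ∈ a.vars)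
    (hv : σ w = Term.var v) : v ∈ (a.subst σ).vars := by
  rw [mem_atom_vars] at hw ⊢
  exact List.mem_map.2 ⟨_, hw, hv⟩

theorem Atom.exists_of_mem_vars_subst {σ : Subst} {a : Atom} {v : ℕ}
    (hv : v ∈ (a.subst σ).vars) : ∃ w ∈ a.vars, σ w = Term.var v := by
  rw [mem_atom_vars] at hv
  obtain ⟨t, ht, h⟩ := List.mem_map.1 hv
  cases t with
  | const c => simp [applyTerm] at h
  | var w => exact ⟨w, mem_atom_vars.2 ht, h⟩

theorem isHom_id (S : Set Atom) : IsHom Term.var S S := fun a ha => by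
  rwa [Atom.subst_var]

theorem IsHom.comp {σ τ : Subst} {S T U : Set Atom} (h : IsHom σ S T) (h' : IsHom τ T U) :
    IsHom (fun v => applyTerm τ (σ v)) S U := fun a ha => by
  rw [← Atom.subst_subst]
  exact h' _ (h a ha)

theorem IsHom.mono {σ : Subst} {S T S' T' : Set Atom} (h : IsHom σ S T) (hS : S' ⊆ S)
    (hT : T ⊆ T') : IsHom σ S' T' := fun a ha => hT (h a (hS ha))

/-! ### Triggers and their fresh variables -/

/-- The natural number identifying a trigger up to irrelevant values of its substitution. -/
def Trigger.code (t : Trigger) : ℕ :=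
  Encodable.encode (t.rule, ((FactBase.vars t.rule.body).sort (· ≤ ·)).map t.map)

theorem Trigger.freshVar_eq (t : Trigger) (z : ℕ) : t.freshVar z = Nat.pair t.code z := rfl

theorem Rule.mem_body_vars_of_mem_head {R : Rule} {v : ℕ} (h : v ∈ FactBase.vars R.head)
    (h' : v ∉ R.exVars) : v ∈ FactBase.vars R.body := by
  by_contra hc
  exact h' (Finset.mem_sdiff.2 ⟨h, hc⟩)

theorem Trigger.ext_of_mem_body (t : Trigger) {v : ℕ} (h : v ∈ FactBase.vars t.rule.body) :
    t.ext v = t.map v := by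
  have : v ∉ t.rule.exVars := fun hc => (Finset.mem_sdiff.1 hc).2 h
  simp [Trigger.ext, this]

theorem Trigger.ext_of_mem_exVars (t : Trigger) {v : ℕ} (h : v ∈ t.rule.exVars) :
    t.ext v = Term.var (t.freshVar v) := by
  simp [Trigger.ext, h]

theorem Trigger.out_eq_of_code_eq {t t' : Trigger} (h : t.code = t'.code) : t.out = t'.out := by
  have h2 := Prod.ext_iff.1 (Encodable.encode_injective h)
  have hR : t.rule = t'.rule := h2.1
  have h3 : ((FactBase.vars t.rule.body).sort (· ≤ ·)).map t.map =
      ((FactBase.vars t'.rule.body).sort (· ≤ ·)).map t'.map := h2.2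
  rw [← hR] at h3
  have hext : ∀ a ∈ t.rule.head, a.subst t.ext = a.subst t'.ext := by
    intro a ha
    refine Atom.subst_congr fun v hv => ?_
    by_cases hz : v ∈ t.rule.exVars
    · rw [t.ext_of_mem_exVars hz, t'.ext_of_mem_exVars (hR ▸ hz), t.freshVar_eq, t'.freshVar_eq, h]
    · have hb := Rule.mem_body_vars_of_mem_head (mem_factBase_vars_of_mem ha hv) hz
      rw [t.ext_of_mem_body hb, t'.ext_of_mem_body (hR ▸ hb)]
      exact List.map_inj_left.1 h3 v ((Finset.mem_sort (· ≤ ·)).2 hb)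
  rw [Trigger.out, Trigger.out, ← hR]
  exact Finset.image_congr hext

theorem Trigger.isHom_ext_head (t : Trigger) : IsHom t.ext ↑t.rule.head ↑t.out := fun _ ha =>
  Finset.mem_coe.2 (Finset.mem_image_of_mem _ ha)

theorem not_out_subset_of_applicable {t : Trigger} {F : FactBase}
    (h : Applicable Variant.E t F) : ¬ t.out ⊆ F := fun hs =>
  h ⟨Term.var, by rw [Finset.union_eq_left.2 hs]; exact isHom_id _⟩

namespace Derivation

variable {𝓡 : RuleSet} {F : FactBase} (D : Derivation 𝓡 F)

theorem fb_subset_succ (i : ℕ) : D.fb i ⊆ D.fb (i + 1) := by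
  by_cases h : (i : ℕ∞) < D.len
  · rw [D.fb_succ i h]; exact Finset.subset_union_left
  · rw [D.fb_stall i h]

theorem fb_mono : Monotone D.fb := monotone_nat_of_le_succ D.fb_subset_succ

theorem out_subset {i j : ℕ} (h : (i : ℕ∞) < D.len) (hij : i < j) : (D.tr i).out ⊆ D.fb j := by
  refine Finset.Subset.trans ?_ (D.fb_mono (Nat.succ_le_of_lt hij))
  rw [Nat.succ_eq_add_one, D.fb_succ i h]
  exact Finset.subset_union_right

theorem code_ne {i j : ℕ} (hi : (i : ℕ∞) < D.len) (hj : (j : ℕ∞) < D.len) (hij : i < j) :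
    (D.tr i).code ≠ (D.tr j).code := fun h => by
  refine D.trig_new j hj ?_
  rw [← Trigger.out_eq_of_code_eq h]
  exact D.out_subset hi hij

theorem mem_vars_of_freshVar_mem (t : Trigger) (z : ℕ) (i : ℕ)
    (h : t.freshVar z ∈ FactBase.vars (D.fb i)) :
    t.freshVar z ∈ FactBase.vars F ∨ t.out ⊆ D.fb i := by
  induction i with
  | zero => rw [D.fb_zero] at h; exact Or.inl h
  | succ i ih =>
    have key : t.freshVar z ∈ FactBase.vars (D.fb i) →
        t.freshVar z ∈ FactBase.vars F ∨ t.out ⊆ D.fb (i + 1) := fun h' =>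
      (ih h').imp_right fun hs => hs.trans (D.fb_subset_succ i)
    by_cases hl : (i : ℕ∞) < D.len
    swap
    · rw [D.fb_stall i hl] at h; exact key h
    rw [D.fb_succ i hl, factBase_vars_union] at h
    rcases h with h | h
    · exact key h
    obtain ⟨b, hb, hv⟩ := mem_factBase_vars.1 h
    obtain ⟨a, ha, rfl⟩ := Finset.mem_image.1 hb
    obtain ⟨w, hw, hwv⟩ := Atom.exists_of_mem_vars_subst hv
    by_cases hz : w ∈ (D.tr i).rule.exVars
    · rw [Trigger.ext_of_mem_exVars _ hz, Term.var.injEq, Trigger.freshVar_eq,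
        Trigger.freshVar_eq, Nat.pair_eq_pair] at hwv
      right
      rw [← Trigger.out_eq_of_code_eq hwv.1]
      exact D.out_subset hl (Nat.lt_succ_self i)
    · have hbody := Rule.mem_body_vars_of_mem_head (mem_factBase_vars_of_mem ha hw) hz
      rw [Trigger.ext_of_mem_body _ hbody] at hwv
      obtain ⟨c, hc, hwc⟩ := mem_factBase_vars.1 hbody
      exact key (mem_factBase_vars_of_mem (D.trig_on i hl c hc) (Atom.mem_vars_subst hwc hwv))

/-- Derivations from variable-free factbases are sound. -/
theorem exists_isHom_of_model (hF : FactBase.vars F = ∅) {N : Set Atom}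
    (hN : IsModelOfKB 𝓡 F N) (i : ℕ) : ∃ σ : Subst, IsHom σ ↑(D.fb i) N := by
  induction i with
  | zero => rw [D.fb_zero]; exact hN.2
  | succ i ih =>
    obtain ⟨σ, hσ⟩ := ih
    by_cases hl : (i : ℕ∞) < D.len
    swap
    · rw [D.fb_stall i hl]; exact ⟨σ, hσ⟩
    obtain ⟨σ', hag, hσ'⟩ := hN.1 _ (D.rule_mem i hl) _ ((D.trig_on i hl).comp hσ)
    refine ⟨fun v => if v ∈ FactBase.vars (D.fb i) then σ v else σ' (Nat.unpair v).2, ?_⟩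
    rw [D.fb_succ i hl]
    intro b hb
    rcases Finset.mem_union.1 (Finset.mem_coe.1 hb) with hb | hb
    · rw [Atom.subst_congr (τ := σ) fun v hv => if_pos (mem_factBase_vars_of_mem hb hv)]
      exact hσ b hb
    · obtain ⟨a, ha, rfl⟩ := Finset.mem_image.1 hb
      rw [Atom.subst_subst, Atom.subst_congr (τ := σ')]
      · exact hσ' a ha
      intro w hw
      by_cases hz : w ∈ (D.tr i).rule.exVars
      · have hnew : (D.tr i).freshVar w ∉ FactBase.vars (D.fb i) := fun hc => by
          rcases D.mem_vars_of_freshVar_mem _ _ _ hc with h | h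
          · simp [hF] at h
          · exact D.trig_new i hl h
        rw [Trigger.ext_of_mem_exVars _ hz, applyTerm, if_neg hnew, Trigger.freshVar_eq,
          Nat.unpair_pair]
      · have hbody := Rule.mem_body_vars_of_mem_head (mem_factBase_vars_of_mem ha hw) hz
        rw [Trigger.ext_of_mem_body _ hbody, hag w hbody]
        refine applyTerm_congr fun v hv => if_pos ?_
        obtain ⟨c, hc, hwc⟩ := mem_factBase_vars.1 hbody
        exact mem_factBase_vars_of_mem (D.trig_on i hl c hc) (Atom.mem_vars_subst hwc hv)

end Derivation

/-! ### Existence of fair derivations -/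

/-- The trigger `t` may be applied to `G` in an E-derivation. -/
def CanFire (𝓡 : RuleSet) (t : Trigger) (G : FactBase) : Prop :=
  t.rule ∈ 𝓡 ∧ t.IsOn G ∧ Applicable Variant.E t G

theorem exists_selection (𝓡 : RuleSet) (G : FactBase) :
    ∃ t : Trigger, ∀ t', CanFire 𝓡 t' G → CanFire 𝓡 t G ∧ t.code ≤ t'.code := by
  by_cases h : ∃ t, CanFire 𝓡 t G
  · have hne : {t | CanFire 𝓡 t G}.Nonempty := h
    exact ⟨Function.argminOn Trigger.code _ hne, fun t' ht' =>
      ⟨Function.argminOn_mem Trigger.code _ hne, Function.argminOn_le Trigger.code _ ht'⟩⟩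
  · exact ⟨⟨⟨{⟨0, []⟩}, {⟨0, []⟩}, Finset.singleton_nonempty _, Finset.singleton_nonempty _⟩,
      Term.var⟩, fun t' ht' => absurd ⟨t', ht'⟩ h⟩

theorem exists_length (p : ℕ → Prop) (hp : ∀ i, ¬ p i → ¬ p (i + 1)) :
    ∃ len : ℕ∞, ∀ i : ℕ, (i : ℕ∞) < len ↔ p i := by
  by_cases h : ∀ i, p i
  · exact ⟨⊤, fun i => by simp [h i]⟩
  · push Not at h
    refine ⟨(Nat.find h : ℕ), fun i => ?_⟩
    rw [Nat.cast_lt, Nat.lt_find_iff]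
    refine ⟨fun hi => not_not.1 (hi i le_rfl), fun hi j hj hc => ?_⟩
    exact Nat.le_induction hc (fun n _ ih => hp n ih) i hj hi

theorem exists_fair_derivation (𝓡 : RuleSet) (F : FactBase) :
    ∃ D : Derivation 𝓡 F, D.IsX Variant.E ∧ D.Fair Variant.E := by
  choose sel hsel using exists_selection 𝓡
  let fb : ℕ → FactBase := fun n => Nat.rec F
    (fun _ G => if ∃ t, CanFire 𝓡 t G then G ∪ (sel G).out else G) n
  have hstep : ∀ i, fb (i + 1) =
    if ∃ t, CanFire 𝓡 t (fb i) then fb i ∪ (sel (fb i)).out else fb i := fun i => rfl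
  have hstall : ∀ i, ¬ (∃ t, CanFire 𝓡 t (fb i)) → fb (i + 1) = fb i := fun i hi => by
    rw [hstep, if_neg hi]
  obtain ⟨len, hlen⟩ := exists_length (fun i => ∃ t, CanFire 𝓡 t (fb i))
    (fun i hi => by rwa [hstall i hi])
  have hfire : ∀ i : ℕ, (i : ℕ∞) < len → CanFire 𝓡 (sel (fb i)) (fb i) := fun i hi =>
    ((hlen i).1 hi).elim fun _ ht => (hsel _ _ ht).1
  let D : Derivation 𝓡 F :=
    { len := len
      fb := fb
      tr := fun i => sel (fb i)
      fb_zero := rfl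
      rule_mem := fun i hi => (hfire i hi).1
      trig_on := fun i hi => (hfire i hi).2.1
      trig_new := fun i hi => not_out_subset_of_applicable (hfire i hi).2.2
      fb_succ := fun i hi => by rw [hstep, if_pos ((hlen i).1 hi)]
      fb_stall := fun i hi => hstall i fun h => hi ((hlen i).2 h) }
  refine ⟨D, fun i hi => (hfire i hi).2.2, fun i _ t htR hton hap => ?_⟩
  by_contra hcon
  push Not at hcon
  have hcan : ∀ k, ((i + k : ℕ) : ℕ∞) < len ∧ CanFire 𝓡 t (fb (i + k)) := by
    intro k
    induction k with
    | zero => exact ⟨(hlen _).2 ⟨t, htR, hton, hap⟩, htR, hton, hap⟩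
    | succ k ih =>
      have hle : ((i + (k + 1) : ℕ) : ℕ∞) ≤ len := by
        have := Order.add_one_le_of_lt ih.1
        exact_mod_cast this
      have hc : CanFire 𝓡 t (fb (i + (k + 1))) :=
        ⟨htR, hton.mono le_rfl (Finset.coe_subset.2 (D.fb_mono (Nat.le_add_right i (k + 1)))),
          hcon _ (by omega) hle⟩
      exact ⟨(hlen _).2 ⟨t, hc⟩, hc⟩
  let f : ℕ → Fin (t.code + 1) := fun k =>
    ⟨(D.tr (i + k)).code, Nat.lt_succ_of_le (hsel _ _ (hcan k).2).2⟩
  obtain ⟨j, k, hjk, hf⟩ := Finite.exists_ne_map_eq_of_infinite f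
  have hf' : (D.tr (i + j)).code = (D.tr (i + k)).code := congrArg Fin.val hf
  rcases Nat.lt_or_gt_of_ne hjk with h | h
  · exact D.code_ne (hcan j).1 (hcan k).1 (by omega) hf'
  · exact D.code_ne (hcan k).1 (hcan j).1 (by omega) hf'.symm

/-! ### Termination for `𝓡₀` -/

/-- The rule `P(x,y) → ∃z.(P(y,z) ∧ P(z,y))`. -/
def R0 : Rule :=
  ⟨{aP vx vy}, {aP vy vz, aP vz vy},
    Finset.singleton_nonempty _, Finset.insert_nonempty _ _⟩

theorem R0set_eq : R0set = {R0} := rfl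

theorem vars_R0_body : FactBase.vars R0.body = {0, 1} := by
  ext v
  simp [mem_factBase_vars, mem_atom_vars, R0, aP, vx, vy]

theorem vars_R0_head : FactBase.vars R0.head = {1, 2} := by
  ext v
  simp [mem_factBase_vars, mem_atom_vars, R0, aP, vy, vz]
  tauto

theorem R0_exVars : R0.exVars = {2} := by
  rw [Rule.exVars, vars_R0_body, vars_R0_head]; decide

theorem R0_frontier : R0.frontier = {1} := by
  rw [Rule.frontier, vars_R0_body, vars_R0_head]; decide

theorem aP_subst (σ : Subst) (t u : Term) :
    (aP t u).subst σ = aP (applyTerm σ t) (applyTerm σ u) := rfl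

theorem isHom_R0_body {σ : Subst} {S : Set Atom} :
    IsHom σ ↑R0.body S ↔ aP (σ 0) (σ 1) ∈ S := by
  simp [IsHom, R0, aP_subst, vx, vy, applyTerm]

theorem isHom_R0_head {σ : Subst} {S : Set Atom} :
    IsHom σ ↑R0.head S ↔ aP (σ 1) (σ 2) ∈ S ∧ aP (σ 2) (σ 1) ∈ S := by
  simp [IsHom, R0, aP_subst, vz, vy, applyTerm]

theorem R0_out {t : Trigger} (h : t.rule = R0) :
    t.out = {aP (t.map 1) (Term.var (t.freshVar 2)), aP (Term.var (t.freshVar 2)) (t.map 1)} := by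
  have h1 : t.ext 1 = t.map 1 := t.ext_of_mem_body (by simp [h, vars_R0_body])
  have h2 : t.ext 2 = Term.var (t.freshVar 2) := t.ext_of_mem_exVars (by simp [h, R0_exVars])
  rw [Trigger.out, h, R0]
  simp [Finset.image_insert, aP_subst, applyTerm, vy, vz, h1, h2]

/-- `u` has a symmetric `P`-neighbour in `G`. -/
def HasMate (G : FactBase) (u : Term) : Prop := ∃ w, aP u w ∈ G ∧ aP w u ∈ G

theorem HasMate.mono {G G' : FactBase} {u : Term} (h : HasMate G u) (hs : G ⊆ G') :
    HasMate G' u :=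
  h.imp fun _ hw => ⟨hs hw.1, hs hw.2⟩

theorem not_applicable_of_hasMate {t : Trigger} {G : FactBase} (hR : t.rule = R0)
    (hon : t.IsOn G) (hfr : t.freshVar 2 ∉ FactBase.vars G) (h : HasMate G (t.map 1)) :
    ¬ Applicable Variant.E t G := by
  obtain ⟨w, hw⟩ := h
  refine not_not.2 ⟨fun v => if v = t.freshVar 2 then w else Term.var v, ?_⟩
  have hfix : ∀ a ∈ G, a.subst (fun v => if v = t.freshVar 2 then w else Term.var v) = a := by
    intro a ha
    conv_rhs => rw [← Atom.subst_var a]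
    refine Atom.subst_congr fun v hv => if_neg ?_
    rintro rfl
    exact hfr (mem_factBase_vars_of_mem ha hv)
  have hmap : applyTerm (fun v => if v = t.freshVar 2 then w else Term.var v) (t.map 1)
      = t.map 1 := by
    conv_rhs => rw [← applyTerm_var (t.map 1)]
    refine applyTerm_congr fun v hv => if_neg ?_
    rintro rfl
    rw [Trigger.IsOn, hR, isHom_R0_body] at hon
    exact hfr (mem_factBase_vars_of_mem hon (by simp [mem_atom_vars, aP, hv]))
  intro a ha
  rcases Finset.mem_union.1 (Finset.mem_coe.1 ha) with ha | ha
  · rw [hfix a ha]; exact ha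
  · rw [R0_out hR, Finset.mem_insert, Finset.mem_singleton] at ha
    rcases ha with rfl | rfl
    · rw [aP_subst, hmap]; simpa [applyTerm] using hw.1
    · rw [aP_subst, hmap]; simpa [applyTerm] using hw.2

theorem mem_terms_or_hasMate {F : FactBase} (D : Derivation R0set F) (i : ℕ) :
    ∀ a ∈ D.fb i, ∀ u ∈ a.args, (∃ a ∈ F, u ∈ a.args) ∨ HasMate (D.fb i) u := by
  induction i with
  | zero => rw [D.fb_zero]; exact fun a ha u hu => Or.inl ⟨a, ha, hu⟩
  | succ i ih =>
    intro a ha u hu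
    by_cases hl : (i : ℕ∞) < D.len
    swap
    · rw [D.fb_stall i hl] at ha ⊢; exact ih a ha u hu
    have ha' := ha
    rw [D.fb_succ i hl, Finset.mem_union] at ha'
    rcases ha' with ha' | ha'
    · exact (ih a ha' u hu).imp_right fun h => h.mono (D.fb_subset_succ i)
    · have hR : (D.tr i).rule = R0 := Finset.mem_singleton.1 (D.rule_mem i hl)
      have hout := D.out_subset hl (Nat.lt_succ_self i)
      rw [R0_out hR] at ha' hout
      have h1 := hout (Finset.mem_insert_self _ _)
      have h2 := hout (Finset.mem_insert_of_mem (Finset.mem_singleton_self _))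
      right
      have hu' : u = (D.tr i).map 1 ∨ u = Term.var ((D.tr i).freshVar 2) := by
        rw [Finset.mem_insert, Finset.mem_singleton] at ha'
        rcases ha' with rfl | rfl <;> simp [aP] at hu <;> tauto
      rcases hu' with rfl | rfl
      · exact ⟨_, h1, h2⟩
      · exact ⟨_, h2, h1⟩

theorem finite_of_isX_R0set {F : FactBase} (D : Derivation R0set F) (hX : D.IsX Variant.E) :
    D.Finite := by
  intro htop
  have hl : ∀ i : ℕ, (i : ℕ∞) < D.len := fun i => by simp [htop]
  have hR : ∀ i, (D.tr i).rule = R0 := fun i => Finset.mem_singleton.1 (D.rule_mem i (hl i))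
  let T : Finset Term := F.biUnion fun a => a.args.toFinset
  have hT : ∀ u, u ∈ T ↔ ∃ a ∈ F, u ∈ a.args := fun u => by simp [T]
  let z : ℕ → ℕ := fun i => (D.tr i).freshVar 2
  let y : ℕ → Term := fun i => (D.tr i).map 1
  have hmate : ∀ i, Term.var (z i) ∉ T → ¬ HasMate (D.fb i) (y i) := by
    intro i hi hm
    refine not_applicable_of_hasMate (hR i) (D.trig_on i (hl i)) (fun hc => ?_) hm (hX i (hl i))
    rcases D.mem_vars_of_freshVar_mem _ _ _ hc with h | h
    · obtain ⟨a, ha, hv⟩ := mem_factBase_vars.1 h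
      exact hi ((hT _).2 ⟨a, ha, mem_atom_vars.1 hv⟩)
    · exact D.trig_new i (hl i) h
  have hy : ∀ i, Term.var (z i) ∉ T → y i ∈ T := by
    intro i hi
    have hon := D.trig_on i (hl i)
    rw [Trigger.IsOn, hR, isHom_R0_body] at hon
    refine (hT _).2 ((mem_terms_or_hasMate D i _ hon (y i) ?_).resolve_right (hmate i hi))
    simp [aP, y]
  let f : ℕ → Bool × T := fun i =>
    if h : Term.var (z i) ∈ T then (true, ⟨_, h⟩) else (false, ⟨_, hy i h⟩)
  have hf : ∀ i j, i < j → f i ≠ f j := by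
    intro i j hij heq
    by_cases hi : Term.var (z i) ∈ T <;> by_cases hj : Term.var (z j) ∈ T <;>
      simp [f, hi, hj] at heq
    · simp only [z, Trigger.freshVar_eq, Nat.pair_eq_pair, and_true] at heq
      exact D.code_ne (hl i) (hl j) hij heq
    · refine hmate j hj ?_
      rw [← heq]
      have hout := D.out_subset (hl i) hij
      rw [R0_out (hR i)] at hout
      exact ⟨_, hout (Finset.mem_insert_self _ _),
        hout (Finset.mem_insert_of_mem (Finset.mem_singleton_self _))⟩
  obtain ⟨i, j, hij, h⟩ := Finite.exists_ne_map_eq_of_infinite f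
  rcases Nat.lt_or_gt_of_ne hij with h' | h'
  · exact hf i j h' h
  · exact hf j i h' h.symm

theorem exists_finite_universal_R0set (F : FactBase) :
    ∃ M : Set Atom, M.Finite ∧ IsUniversalModel R0set F M := by
  let m : ℕ := (FactBase.vars F).sup id + 1
  have hm : ∀ v ∈ FactBase.vars F, v < m := fun v hv =>
    Nat.lt_succ_of_le (Finset.le_sup (f := id) hv)
  let T : Finset Term := F.biUnion fun a => a.args.toFinset
  let z : Term → Term := fun u => Term.var (m + Encodable.encode u)
  let U : Finset Term := T.filter fun u => ∃ x, aP x u ∈ F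
  have hU : ∀ u, u ∈ U ↔ ∃ x, aP x u ∈ F := fun u => by
    simp only [U, T, Finset.mem_filter, Finset.mem_biUnion, and_iff_right_iff_imp]
    rintro ⟨x, hx⟩
    exact ⟨_, hx, by simp [aP]⟩
  let M : Finset Atom := F ∪ (U.image (fun u => aP u (z u)) ∪ U.image (fun u => aP (z u) u))
  have hM : ∀ a, a ∈ M ↔ a ∈ F ∨ ∃ u ∈ U, a = aP u (z u) ∨ a = aP (z u) u := fun a => by
    simp only [M, Finset.mem_union, Finset.mem_image]
    constructor
    · rintro (h | ⟨u, hu, rfl⟩ | ⟨u, hu, rfl⟩)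
      · exact Or.inl h
      · exact Or.inr ⟨u, hu, Or.inl rfl⟩
      · exact Or.inr ⟨u, hu, Or.inr rfl⟩
    · rintro (h | ⟨u, hu, rfl | rfl⟩)
      · exact Or.inl h
      · exact Or.inr (Or.inl ⟨u, hu, rfl⟩)
      · exact Or.inr (Or.inr ⟨u, hu, rfl⟩)
  refine ⟨↑M, M.finite_toSet, ⟨?_, Term.var, ?_⟩, ?_⟩
  · intro R hR
    rw [R0set_eq, Finset.mem_singleton] at hR
    subst hR
    intro σ hσ
    rw [isHom_R0_body, Finset.mem_coe, hM] at hσ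
    have : ∃ w, aP (σ 1) w ∈ M ∧ aP w (σ 1) ∈ M := by
      have hmate : ∀ u ∈ U, aP u (z u) ∈ M ∧ aP (z u) u ∈ M := fun u hu =>
        ⟨(hM _).2 (Or.inr ⟨u, hu, Or.inl rfl⟩), (hM _).2 (Or.inr ⟨u, hu, Or.inr rfl⟩)⟩
      rcases hσ with h | ⟨u, hu, h | h⟩
      · exact ⟨_, hmate _ ((hU _).2 ⟨_, h⟩)⟩
      · simp only [aP, Atom.mk.injEq, List.cons.injEq, and_true, true_and] at h
        exact ⟨u, by rw [h.2]; exact (hmate u hu).symm⟩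
      · simp only [aP, Atom.mk.injEq, List.cons.injEq, and_true, true_and] at h
        exact ⟨z u, by rw [h.2]; exact hmate u hu⟩
    obtain ⟨w, hw⟩ := this
    refine ⟨Function.update σ 2 w, fun v hv => Function.update_of_ne ?_ _ _, ?_⟩
    · rintro rfl; simp [vars_R0_body] at hv
    · rw [isHom_R0_head]; simpa [Function.update] using hw
  · exact (isHom_id _).mono subset_rfl fun a ha => (hM a).2 (Or.inl ha)
  · rintro N ⟨hN, σ, hσ⟩
    have hmate : ∀ u, ∃ w, u ∈ U → aP (applyTerm σ u) w ∈ N ∧ aP w (applyTerm σ u) ∈ N := by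
      intro u
      by_cases hu : u ∈ U
      · obtain ⟨x, hx⟩ := (hU u).1 hu
        have hb := hσ _ hx
        rw [aP_subst] at hb
        obtain ⟨σ', hag, hh⟩ := hN R0 (Finset.mem_singleton_self _)
          (fun v => if v = 0 then applyTerm σ x else applyTerm σ u)
          (isHom_R0_body.2 (by simpa using hb))
        rw [isHom_R0_head, hag 1 (by simp [vars_R0_body])] at hh
        exact ⟨σ' 2, fun _ => by simpa using hh⟩
      · exact ⟨u, fun h => absurd h hu⟩
    choose w hw using hmate
    let τ : Subst := fun v =>
      if v < m then σ v else (Encodable.decode (α := Term) (v - m)).elim (σ v) w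
    have hτz : ∀ u, applyTerm τ (z u) = w u := fun u => by
      simp [τ, z, applyTerm]
    have hτF : ∀ a ∈ F, a.subst τ = a.subst σ := fun a ha =>
      Atom.subst_congr fun v hv => if_pos (hm v (mem_factBase_vars_of_mem ha hv))
    have hτu : ∀ u ∈ U, applyTerm τ u = applyTerm σ u := fun u hu => by
      obtain ⟨x, hx⟩ := (hU u).1 hu
      have := hτF _ hx
      rw [aP_subst, aP_subst] at this
      simp only [aP, Atom.mk.injEq, List.cons.injEq, and_true, true_and] at this
      exact this.2
    refine ⟨τ, fun a ha => ?_⟩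
    rcases (hM a).1 ha with ha | ⟨u, hu, rfl | rfl⟩
    · rw [hτF a ha]; exact hσ a ha
    · rw [aP_subst, hτu u hu, hτz]; exact (hw u hu).1
    · rw [aP_subst, hτu u hu, hτz]; exact (hw u hu).2

/-! ### Non-termination for the one-way atomic decomposition of `𝓡₀` -/

/-- The atom `X(t,u)` over the fresh predicate of `R0`. -/
def aX (t u : Term) : Atom := ⟨freshPred R0set R0, [t, u]⟩

theorem aX_subst (σ : Subst) (t u : Term) :
    (aX t u).subst σ = aX (applyTerm σ t) (applyTerm σ u) := rfl

theorem aX_ne_aP (t u t' u' : Term) : aX t u ≠ aP t' u' := by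
  intro h
  have := congrArg Atom.pred h
  simp [aX, aP, freshPred] at this

theorem aX_inj {t u t' u' : Term} : aX t u = aX t' u' ↔ t = t' ∧ u = u' := by
  simp [aX]

theorem aP_inj {t u t' u' : Term} : aP t u = aP t' u' ↔ t = t' ∧ u = u' := by
  simp [aP]

theorem xAtom_R0 : xAtom R0set R0 = aX vy vz := by
  simp [xAtom, R0_exVars, R0_frontier, aX, vy, vz]

/-- The rule `P(x,y) → ∃z.X(y,z)`. -/
def ruleX : Rule :=
  ⟨{aP vx vy}, {aX vy vz}, Finset.singleton_nonempty _, Finset.singleton_nonempty _⟩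

/-- The rule `X(y,z) → a`. -/
def ruleHead (a : Atom) : Rule :=
  ⟨{aX vy vz}, {a}, Finset.singleton_nonempty _, Finset.singleton_nonempty _⟩

theorem mem_oneAd_R0set {R : Rule} : R ∈ oneAd R0set ↔
    R = ruleX ∨ R = ruleHead (aP vy vz) ∨ R = ruleHead (aP vz vy) := by
  rw [oneAd, R0set_eq, Finset.singleton_biUnion, oneAdRule, ← R0set_eq]
  simp only [xAtom_R0, Finset.mem_insert, Finset.mem_image, Finset.mem_attach, true_and,
    Subtype.exists]
  refine or_congr Iff.rfl ⟨?_, ?_⟩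
  · rintro ⟨a, ha, rfl⟩
    simp only [R0, Finset.mem_insert, Finset.mem_singleton] at ha
    rcases ha with rfl | rfl
    · exact Or.inl rfl
    · exact Or.inr rfl
  · rintro (rfl | rfl)
    · exact ⟨aP vy vz, by simp [R0], rfl⟩
    · exact ⟨aP vz vy, by simp [R0], rfl⟩

/-- Every rule instance in `M` is satisfied up to an endomorphism of `M`. -/
def SatisfiesUpToEndo (𝓡 : RuleSet) (M : Set Atom) : Prop :=
  ∀ R ∈ 𝓡, ∀ π : Subst, IsHom π ↑R.body M → ∃ h π' : Subst, IsHom h M M ∧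
    (∀ v ∈ FactBase.vars R.body, π' v = applyTerm h (π v)) ∧ IsHom π' ↑R.head M

theorem IsModelOfRules.satisfiesUpToEndo {𝓡 : RuleSet} {M : Set Atom}
    (hM : IsModelOfRules 𝓡 M) : SatisfiesUpToEndo 𝓡 M := by
  intro R hR π hπ
  obtain ⟨σ', h1, h2⟩ := hM R hR π hπ
  exact ⟨Term.var, σ', isHom_id M, fun v hv => by rw [h1 v hv, applyTerm_var], h2⟩

theorem satisfiesUpToEndo_of_not_canFire {𝓡 : RuleSet} {G : FactBase}
    (h : ∀ t, ¬ CanFire 𝓡 t G) : SatisfiesUpToEndo 𝓡 (↑G : Set Atom) := by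
  intro R hR π hπ
  have hna : ¬ Applicable Variant.E ⟨R, π⟩ G := fun hc => h ⟨R, π⟩ ⟨hR, hπ, hc⟩
  obtain ⟨σ, hσ⟩ := not_not.1 hna
  refine ⟨σ, fun v => applyTerm σ (Trigger.ext ⟨R, π⟩ v), hσ.mono (by simp) subset_rfl,
    fun v hv => ?_, ?_⟩
  · exact congrArg _ (Trigger.ext_of_mem_body ⟨R, π⟩ hv)
  · exact (Trigger.isHom_ext_head ⟨R, π⟩).comp (hσ.mono (by simp) subset_rfl)

theorem Derivation.not_canFire_of_fair {𝓡 : RuleSet} {F : FactBase} (D : Derivation 𝓡 F)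
    (hf : D.Fair Variant.E) {n : ℕ} (hn : D.len = n) (t : Trigger) :
    ¬ CanFire 𝓡 t (D.fb n) := by
  rintro ⟨h1, h2, h3⟩
  obtain ⟨j, hj, hjn, _⟩ := hf n hn.ge t h1 h2 h3
  rw [hn, Nat.cast_le] at hjn
  omega

theorem SatisfiesUpToEndo.exists_aX {M : Set Atom} (hM : SatisfiesUpToEndo (oneAd R0set) M)
    {t u : Term} (h : aP t u ∈ M) :
    ∃ (σ : Subst) (w : Term), IsHom σ M M ∧ aX (applyTerm σ u) w ∈ M := by
  obtain ⟨σ, π, hσ, h1, h2⟩ := hM ruleX (mem_oneAd_R0set.2 (Or.inl rfl))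
    (fun v => if v = 0 then t else u)
    (by simpa [IsHom, ruleX, aP_subst, applyTerm, vx, vy] using h)
  have h3 := h1 1 (by simp [ruleX, mem_factBase_vars, mem_atom_vars, aP, vy])
  have h4 := h2 (aX vy vz) (by simp [ruleX])
  rw [aX_subst, vy, applyTerm, h3] at h4
  exact ⟨σ, _, hσ, h4⟩

theorem SatisfiesUpToEndo.exists_aP {M : Set Atom} (hM : SatisfiesUpToEndo (oneAd R0set) M)
    {t u : Term} (h : aX t u ∈ M) :
    ∃ σ : Subst, IsHom σ M M ∧ aP (applyTerm σ t) (applyTerm σ u) ∈ M := by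
  obtain ⟨σ, π, hσ, h1, h2⟩ := hM (ruleHead (aP vy vz)) (mem_oneAd_R0set.2 (Or.inr (Or.inl rfl)))
    (fun v => if v = 1 then t else u)
    (by simpa [IsHom, ruleHead, aX_subst, applyTerm, vz, vy] using h)
  have h3 := h1 1 (by simp [ruleHead, mem_factBase_vars, mem_atom_vars, aX, vy])
  have h4 := h1 2 (by simp [ruleHead, mem_factBase_vars, mem_atom_vars, aX, vz])
  have h5 := h2 (aP vy vz) (by simp [ruleHead])
  rw [aP_subst, vy, vz, applyTerm, applyTerm, h3, h4] at h5
  exact ⟨σ, hσ, by simpa using h5⟩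

/-- `M` has an `X`-path of length `k` starting in the constant `b`, whose end point has an
incoming `P`-edge. -/
def HasPath (M : Set Atom) (k : ℕ) : Prop :=
  ∃ p : ℕ → Term, p 0 = Term.const 1 ∧ (∀ i < k, aX (p i) (p (i + 1)) ∈ M) ∧ ∃ w, aP w (p k) ∈ M

theorem SatisfiesUpToEndo.hasPath {M : Set Atom} (hM : SatisfiesUpToEndo (oneAd R0set) M)
    (hab : aP (Term.const 0) (Term.const 1) ∈ M) (k : ℕ) : HasPath M k := by
  induction k with
  | zero => exact ⟨fun _ => Term.const 1, rfl, by simp, _, hab⟩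
  | succ k ih =>
    obtain ⟨p, hp0, hp, w, hw⟩ := ih
    obtain ⟨σ, z, hσ, hz⟩ := hM.exists_aX hw
    let q : ℕ → Term := fun i => if i ≤ k then applyTerm σ (p i) else z
    have hq : ∀ i < k + 1, aX (q i) (q (i + 1)) ∈ M := by
      intro i hi
      rcases Nat.lt_succ_iff_lt_or_eq.1 hi with hi | rfl
      · have := hσ _ (hp i hi)
        rw [aX_subst] at this
        simpa [q, hi.le, Nat.succ_le_of_lt hi] using this
      · simpa [q] using hz
    obtain ⟨τ, hτ, hP⟩ := hM.exists_aP (hq k (Nat.lt_succ_self k))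
    refine ⟨fun i => applyTerm τ (q i), by simp [q, hp0, applyTerm], fun i hi => ?_, _, hP⟩
    have := hτ _ (hq i hi)
    rwa [aX_subst] at this

/-- The vertices `b, e₁, e₂, …` of the infinite chain model. -/
def chainVertex : ℕ → Term
  | 0 => Term.const 1
  | i + 1 => Term.var i

theorem chainVertex_injective : Function.Injective chainVertex := by
  intro i j h
  cases i <;> cases j <;> simp_all [chainVertex]

/-- The infinite chain model of `⟨1ad(𝓡₀), {P(a,b)}⟩`. -/
def chainModel : Set Atom :=
  {a | a = aP (Term.const 0) (Term.const 1) ∨ ∃ i,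
    a = aX (chainVertex i) (chainVertex (i + 1)) ∨
    a = aP (chainVertex i) (chainVertex (i + 1)) ∨ a = aP (chainVertex (i + 1)) (chainVertex i)}

theorem aX_mem_chainModel {t u : Term} : aX t u ∈ chainModel ↔
    ∃ i, t = chainVertex i ∧ u = chainVertex (i + 1) := by
  simp [chainModel, aX_ne_aP, aX_inj]

theorem exists_of_aP_mem_chainModel {t u : Term} (h : aP t u ∈ chainModel) :
    ∃ i, u = chainVertex i := by
  rcases h with h | ⟨i, h | h | h⟩
  · exact ⟨0, (aP_inj.1 h).2⟩
  · exact absurd h.symm (aX_ne_aP _ _ _ _)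
  · exact ⟨_, (aP_inj.1 h).2⟩
  · exact ⟨_, (aP_inj.1 h).2⟩

theorem isModelOfKB_chainModel : IsModelOfKB (oneAd R0set) Fab chainModel := by
  refine ⟨fun R hR σ hσ => ?_, Term.var, (isHom_id _).mono subset_rfl fun a ha => Or.inl ?_⟩
  swap
  · simpa [Fab] using ha
  rcases mem_oneAd_R0set.1 hR with rfl | rfl | rfl
  · have h := hσ (aP vx vy) (by simp [ruleX])
    rw [aP_subst] at h
    obtain ⟨i, hi⟩ := exists_of_aP_mem_chainModel h
    refine ⟨Function.update σ 2 (chainVertex (i + 1)),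
      fun v hv => Function.update_of_ne ?_ _ _, ?_⟩
    · rintro rfl
      simp [ruleX, mem_factBase_vars, mem_atom_vars, aP, vx, vy] at hv
    · simp only [vy, applyTerm] at hi
      simp [IsHom, ruleX, aX_subst, vy, vz, applyTerm, aX_mem_chainModel, hi]
      exact ⟨i, rfl, rfl⟩
  · have h := hσ (aX vy vz) (by simp [ruleHead])
    rw [aX_subst, aX_mem_chainModel] at h
    obtain ⟨i, hi, hi'⟩ := h
    refine ⟨σ, fun _ _ => rfl, fun a ha => ?_⟩
    obtain rfl : a = aP vy vz := by simpa [ruleHead] using ha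
    rw [aP_subst, hi, hi']
    exact Or.inr ⟨i, Or.inr (Or.inl rfl)⟩
  · have h := hσ (aX vy vz) (by simp [ruleHead])
    rw [aX_subst, aX_mem_chainModel] at h
    obtain ⟨i, hi, hi'⟩ := h
    refine ⟨σ, fun _ _ => rfl, fun a ha => ?_⟩
    obtain rfl : a = aP vz vy := by simpa [ruleHead] using ha
    rw [aP_subst, hi, hi']
    exact Or.inr ⟨i, Or.inr (Or.inr rfl)⟩

theorem HasPath.le_ncard {M : Set Atom} {k : ℕ} (h : HasPath M k) (hfin : M.Finite) {σ : Subst}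
    (hσ : IsHom σ M chainModel) : k ≤ M.ncard := by
  obtain ⟨p, hp0, hp, -⟩ := h
  have hσp : ∀ i ≤ k, applyTerm σ (p i) = chainVertex i := by
    intro i
    induction i with
    | zero => intro _; rw [hp0]; rfl
    | succ i ih =>
      intro hi
      have h := hσ _ (hp i hi)
      rw [aX_subst, aX_mem_chainModel, ih (by omega)] at h
      obtain ⟨j, hj, hj'⟩ := h
      rw [hj', chainVertex_injective hj]
  have hinj : Set.InjOn (fun i => aX (p i) (p (i + 1))) ↑(Finset.range k) := by
    intro i hi j hj hij
    simp only [Finset.coe_range, Set.mem_Iio] at hi hj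
    apply chainVertex_injective
    rw [← hσp i hi.le, ← hσp j hj.le, (aX_inj.1 hij).1]
  have hsub : (fun i => aX (p i) (p (i + 1))) '' ↑(Finset.range k) ⊆ M := by
    rintro _ ⟨i, hi, rfl⟩
    exact hp i (by simpa using hi)
  have := Set.ncard_le_ncard hsub hfin
  rwa [hinj.ncard_image, Set.ncard_coe_finset, Finset.card_range] at this

theorem SatisfiesUpToEndo.not_finite {M : Set Atom} (hM : SatisfiesUpToEndo (oneAd R0set) M)
    (hab : aP (Term.const 0) (Term.const 1) ∈ M) {σ : Subst} (hσ : IsHom σ M chainModel) :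
    ¬ M.Finite := fun hfin => by
  have := (hM.hasPath hab (M.ncard + 1)).le_ncard hfin hσ
  omega

theorem not_exists_finite_fair_oneAd :
    ¬ ∃ D : Derivation (oneAd R0set) Fab,
      D.IsX Variant.E ∧ D.Fair Variant.E ∧ D.Finite := by
  rintro ⟨D, -, hfair, hfin⟩
  obtain ⟨n, hn⟩ := ENat.ne_top_iff_exists.1 hfin
  obtain ⟨σ, hσ⟩ := D.exists_isHom_of_model
    (by ext v; simp [mem_factBase_vars, mem_atom_vars, Fab, aP]) isModelOfKB_chainModel n
  refine (satisfiesUpToEndo_of_not_canFire (D.not_canFire_of_fair hfair hn.symm)).not_finite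
    (D.fb_mono (Nat.zero_le n) ?_) hσ (D.fb n).finite_toSet
  rw [D.fb_zero]
  exact Finset.mem_singleton_self _

theorem not_exists_finite_universal_oneAd :
    ¬ ∃ M : Set Atom, M.Finite ∧ IsUniversalModel (oneAd R0set) Fab M := by
  rintro ⟨M, hfin, ⟨hM, σ, hσ⟩, huniv⟩
  obtain ⟨τ, hτ⟩ := huniv _ isModelOfKB_chainModel
  exact hM.satisfiesUpToEndo.not_finite
    (hσ (aP (Term.const 0) (Term.const 1)) (by simp [Fab])) hτ hfin

/-- The one-way atomic decomposition does not preserve termination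
of the equivalent chase: `𝓡₀ ∈ CT_E^∀` but `1ad(𝓡₀) ∉ CT_E^∀`; in particular
`⟨1ad(𝓡₀), {P(a,b)}⟩` admits no finite fair E-derivation (equivalently, no finite
universal model), while every KB `⟨𝓡₀, F⟩` admits one. -/
theorem statement9 :
    CTall Variant.E R0set ∧ ¬ CTall Variant.E (oneAd R0set) ∧
    (¬ ∃ D : Derivation (oneAd R0set) Fab,
        D.IsX Variant.E ∧ D.Fair Variant.E ∧ D.Finite) ∧
    (¬ ∃ M : Set Atom, M.Finite ∧ IsUniversalModel (oneAd R0set) Fab M) ∧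
    (∀ F : FactBase, ∃ D : Derivation R0set F,
        D.IsX Variant.E ∧ D.Fair Variant.E ∧ D.Finite) ∧
    (∀ F : FactBase, ∃ M : Set Atom, M.Finite ∧ IsUniversalModel R0set F M) := by
  refine ⟨fun _ D hX _ => finite_of_isX_R0set D hX, fun h => ?_, not_exists_finite_fair_oneAd,
    not_exists_finite_universal_oneAd, fun F => ?_, exists_finite_universal_R0set⟩
  · obtain ⟨D, hX, hf⟩ := exists_fair_derivation (oneAd R0set) Fab
    exact not_exists_finite_fair_oneAd ⟨D, hX, hf, h _ D hX hf⟩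
  · obtain ⟨D, hX, hf⟩ := exists_fair_derivation R0set F
    exact ⟨D, hX, hf, finite_of_isX_R0set D hX⟩

end
end ExRules
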